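/- For every dissection W of P, the convex hull of the points x(T), over all triangulations T of P with W ⊆ T, equals the set of all x ∈ ℝ^{n+1} satisfying: Σ_{j∈[n+1]} x_j = (n+2)(n+1)/2; Σ_{j∈Bel(δ)} x_j ≥ (bel(δ)+1)·bel(δ)/2 for every internal diagonal δ of P; and Σ_{j∈Bel(δ)} x_j = (bel(δ)+1)·bel(δ)/2 for every δ ∈ W. -/

import Mathlib

attribute [local instance] Classical.propDecidable

noncomputable section

namespace Spines

/-- Position of vertex `v ∈ {0,…,n+2}` in the counterclockwise boundary cyclic order:
`0`, then the elements of `D` in increasing order, then `n+2`, then the elements of `U`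
in decreasing order. -/
def pos (n : ℕ) (D U : Finset ℕ) (v : ℕ) : ℕ :=
  if v = 0 then 0
  else if v = n + 2 then D.card + 1
  else if v ∈ D then 1 + (D.filter (fun d => d < v)).card
  else D.card + 2 + (U.filter (fun u => v < u)).card

/-- Cyclic distance from `a` to `v` in counterclockwise direction. -/
def relpos (n : ℕ) (D U : Finset ℕ) (a v : ℕ) : ℕ :=
  (pos n D U v + (n + 3) - pos n D U a) % (n + 3)

/-- `v` lies strictly inside the counterclockwise boundary arc from `a` to `b`. -/
def StrictBetween (n : ℕ) (D U : Finset ℕ) (a b v : ℕ) : Prop :=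
  v ≤ n + 2 ∧ 0 < relpos n D U a v ∧ relpos n D U a v < relpos n D U a b

/-- A diagonal, encoded as an ordered pair `(a,b)` with `a < b ≤ n+2`. -/
def IsDiag (n : ℕ) (δ : ℕ × ℕ) : Prop := δ.1 < δ.2 ∧ δ.2 ≤ n + 2

/-- A boundary edge: the endpoints are adjacent in the cyclic order. -/
def IsBoundaryEdge (n : ℕ) (D U : Finset ℕ) (δ : ℕ × ℕ) : Prop :=
  IsDiag n δ ∧ (relpos n D U δ.1 δ.2 = 1 ∨ relpos n D U δ.2 δ.1 = 1)

/-- An internal diagonal. -/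
def IsInternalDiag (n : ℕ) (D U : Finset ℕ) (δ : ℕ × ℕ) : Prop :=
  IsDiag n δ ∧ ¬ IsBoundaryEdge n D U δ

/-- Two diagonals cross: the four endpoints are pairwise distinct and exactly one
endpoint of the second lies strictly inside each of the two arcs determined by the first. -/
def Cross (n : ℕ) (D U : Finset ℕ) (δ δ' : ℕ × ℕ) : Prop :=
  δ.1 ≠ δ.2 ∧ δ'.1 ≠ δ'.2 ∧ δ.1 ≠ δ'.1 ∧ δ.1 ≠ δ'.2 ∧ δ.2 ≠ δ'.1 ∧ δ.2 ≠ δ'.2 ∧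
  ((StrictBetween n D U δ.1 δ.2 δ'.1 ∧ StrictBetween n D U δ.2 δ.1 δ'.2) ∨
   (StrictBetween n D U δ.1 δ.2 δ'.2 ∧ StrictBetween n D U δ.2 δ.1 δ'.1))

/-- A triangulation: a maximal set of pairwise non-crossing internal diagonals. -/
def IsTriangulation (n : ℕ) (D U : Finset ℕ) (T : Finset (ℕ × ℕ)) : Prop :=
  (∀ δ ∈ T, IsInternalDiag n D U δ) ∧
  (∀ δ ∈ T, ∀ δ' ∈ T, ¬ Cross n D U δ δ') ∧
  (∀ δ, IsInternalDiag n D U δ → δ ∉ T → ∃ δ' ∈ T, Cross n D U δ δ')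

/-- `a` and `b` (with `a < b`) are joined by a diagonal of `T` or a boundary edge. -/
def EdgeOf (n : ℕ) (D U : Finset ℕ) (T : Finset (ℕ × ℕ)) (a b : ℕ) : Prop :=
  (a, b) ∈ T ∨ IsBoundaryEdge n D U (a, b)

/-- `{i,j,k}` with `i<j<k` is a triangle of the triangulation `T`. -/
def IsTriangleOf (n : ℕ) (D U : Finset ℕ) (T : Finset (ℕ × ℕ)) (i j k : ℕ) : Prop :=
  i < j ∧ j < k ∧ k ≤ n + 2 ∧
    EdgeOf n D U T i j ∧ EdgeOf n D U T j k ∧ EdgeOf n D U T i k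

/-- `Bel δ`: labels in `[n+1]` strictly inside the ccw arc from `δ.1` to `δ.2`,
together with the endpoints of `δ` lying in `U`. -/
def Bel (n : ℕ) (D U : Finset ℕ) (δ : ℕ × ℕ) : Finset ℕ :=
  (Finset.Icc 1 (n + 1)).filter
    (fun j => StrictBetween n D U δ.1 δ.2 j ∨ (j ∈ U ∧ (j = δ.1 ∨ j = δ.2)))

def bel (n : ℕ) (D U : Finset ℕ) (δ : ℕ × ℕ) : ℕ := (Bel n D U δ).card

def Abo (n : ℕ) (D U : Finset ℕ) (δ : ℕ × ℕ) : Finset ℕ :=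
  Finset.Icc 1 (n + 1) \ Bel n D U δ

/-- The coordinates of the point `x(T)` associated to a triangulation `T`. -/
def xcoord (n : ℕ) (D U : Finset ℕ) (T : Finset (ℕ × ℕ)) (j : ℕ) : ℝ :=
  if h : ∃ p : ℕ × ℕ, IsTriangleOf n D U T p.1 j p.2 then
    if j ∈ D then
      ((bel n D U (h.choose.1, j) : ℝ) + 1) * ((bel n D U (j, h.choose.2) : ℝ) + 1)
    else
      ((n : ℝ) + 2) -
        (((n : ℝ) + 2) - (bel n D U (h.choose.1, j) : ℝ)) *
          (((n : ℝ) + 2) - (bel n D U (j, h.choose.2) : ℝ))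
  else 0

/-- Middle vertex of the triple `{a,b,c}` with `a < b` and `c ∉ {a,b}`. -/
def midOf (a b c : ℕ) : ℕ := if c < a then a else if c < b then c else b

/-- `c` is the third vertex of a triangle of `T` containing the diagonal `δ`. -/
def TriWith (n : ℕ) (D U : Finset ℕ) (T : Finset (ℕ × ℕ)) (δ : ℕ × ℕ) (c : ℕ) : Prop :=
  if c < δ.1 then IsTriangleOf n D U T c δ.1 δ.2
  else if c < δ.2 then IsTriangleOf n D U T δ.1 c δ.2
  else IsTriangleOf n D U T δ.1 δ.2 c

/-- `s_δ`: middle vertex of the triangle of `T` below `δ` (third vertex strictly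
inside the ccw arc from `δ.1` to `δ.2`). -/
def spineSrc (n : ℕ) (D U : Finset ℕ) (T : Finset (ℕ × ℕ)) (δ : ℕ × ℕ) : ℕ :=
  if h : ∃ c, StrictBetween n D U δ.1 δ.2 c ∧ TriWith n D U T δ c then
    midOf δ.1 δ.2 h.choose
  else 0

/-- `t_δ`: middle vertex of the triangle of `T` above `δ` (third vertex strictly
inside the ccw arc from `δ.2` to `δ.1`). -/
def spineTgt (n : ℕ) (D U : Finset ℕ) (T : Finset (ℕ × ℕ)) (δ : ℕ × ℕ) : ℕ :=
  if h : ∃ c, StrictBetween n D U δ.2 δ.1 c ∧ TriWith n D U T δ c then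
    midOf δ.1 δ.2 h.choose
  else 0

/-- `(p,q)` is an arc of the spine of `T`. -/
def SpineArc (n : ℕ) (D U : Finset ℕ) (T : Finset (ℕ × ℕ)) (p q : ℕ) : Prop :=
  ∃ δ ∈ T, spineSrc n D U T δ = p ∧ spineTgt n D U T δ = q

/-- The finite set of all triangulations of the polygon. -/
def allTri (n : ℕ) (D U : Finset ℕ) : Finset (Finset (ℕ × ℕ)) :=
  ((Finset.range (n + 3) ×ˢ Finset.range (n + 3)).filter
      (fun δ => IsInternalDiag n D U δ)).powerset.filter
    (fun T => IsTriangulation n D U T)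

end Spines

namespace Spines

section Positions

variable {n : ℕ} {D U : Finset ℕ}

theorem card_add_card (hUD : D ∪ U = Finset.Icc 1 (n + 1)) (hdisj : Disjoint D U) :
    D.card + U.card = n + 1 := by
  have h := Finset.card_union_of_disjoint hdisj
  rw [hUD, Nat.card_Icc] at h
  omega

theorem mem_or_mem (hUD : D ∪ U = Finset.Icc 1 (n + 1)) {j : ℕ} :
    j ∈ D ∨ j ∈ U ↔ 1 ≤ j ∧ j ≤ n + 1 := by
  rw [← Finset.mem_union, hUD, Finset.mem_Icc]

theorem pos_lt_pos_of_notMem (hUD : D ∪ U = Finset.Icc 1 (n + 1)) {v w : ℕ}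
    (hvw : v < w) (hw : w ≤ n + 2) (hv : v ∉ U) : pos n D U v < pos n D U w := by
  have hvD : v ≠ 0 → v ∈ D := fun h0 =>
    ((mem_or_mem hUD).2 ⟨by omega, by omega⟩).resolve_right hv
  have hlt : v ∈ D → (D.filter (fun d => d < v)).card < D.card := fun h =>
    Finset.card_lt_card (Finset.filter_ssubset.2 ⟨v, h, lt_irrefl v⟩)
  have hmono : v ∈ D → (D.filter (fun d => d < v)).card < (D.filter (fun d => d < w)).card := by
    intro h
    refine Finset.card_lt_card (Finset.ssubset_iff_of_subset ?_ |>.2 ⟨v, by simp [h, hvw], by simp⟩)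
    intro d
    simp only [Finset.mem_filter]
    exact fun hd => ⟨hd.1, hd.2.trans hvw⟩
  unfold pos
  split_ifs <;> first | omega | (have := hvD ‹_›; have := hlt this; have := hmono ‹_›; first | omega | contradiction)

theorem pos_lt_pos_of_mem (hUD : D ∪ U = Finset.Icc 1 (n + 1)) (hdisj : Disjoint D U)
    {v w : ℕ} (hvw : v < w) (hw : w ≤ n + 2) (hv : v ∈ U) : pos n D U w < pos n D U v := by
  have hvI := (mem_or_mem hUD).1 (Or.inr hv)
  have hvD : v ∉ D := fun h => Finset.disjoint_left.1 hdisj h hv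
  have hle : (D.filter (fun d => d < w)).card ≤ D.card := Finset.card_filter_le _ _
  have hmono : w ≠ n + 2 → w ∉ D →
      (U.filter (fun u => w < u)).card < (U.filter (fun u => v < u)).card := by
    intro h h'
    have hwU : w ∈ U := ((mem_or_mem hUD).2 ⟨by omega, by omega⟩).resolve_left h'
    refine Finset.card_lt_card
      (Finset.ssubset_iff_of_subset ?_ |>.2 ⟨w, by simp [hwU, hvw], by simp⟩)
    intro d
    simp only [Finset.mem_filter]
    exact fun hd => ⟨hd.1, hvw.trans hd.2⟩
  unfold pos
  rw [if_neg (by omega : v ≠ 0), if_neg (by omega : v ≠ n + 2), if_neg hvD,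
    if_neg (by omega : w ≠ 0)]
  split_ifs with h1 h2
  · omega
  · omega
  · have := hmono h1 h2
    omega

theorem pos_lt (hUD : D ∪ U = Finset.Icc 1 (n + 1)) (hdisj : Disjoint D U) {v : ℕ}
    (hv : v ≤ n + 2) : pos n D U v < n + 3 := by
  have hc := card_add_card hUD hdisj
  have hle : (D.filter (fun d => d < v)).card ≤ D.card := Finset.card_filter_le _ _
  unfold pos
  split_ifs with h1 h2 h3
  · omega
  · omega
  · omega
  · have hvU : v ∈ U := ((mem_or_mem hUD).2 ⟨by omega, by omega⟩).resolve_left h3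
    have : (U.filter (fun u => v < u)).card < U.card :=
      Finset.card_lt_card (Finset.filter_ssubset.2 ⟨v, hvU, lt_irrefl v⟩)
    omega

/-- `y` is met strictly between `x` and `z` when going around a cycle in increasing order. -/
def CycBetween (x y z : ℕ) : Prop := x < y ∧ y < z ∨ y < z ∧ z < x ∨ z < x ∧ x < y

theorem relpos_eq (hUD : D ∪ U = Finset.Icc 1 (n + 1)) (hdisj : Disjoint D U) {a v : ℕ}
    (ha : a ≤ n + 2) (hv : v ≤ n + 2) :
    relpos n D U a v = if pos n D U a ≤ pos n D U v then pos n D U v - pos n D U a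
      else pos n D U v + (n + 3) - pos n D U a := by
  have h1 := pos_lt hUD hdisj ha
  have h2 := pos_lt hUD hdisj hv
  unfold relpos
  split_ifs with h
  · rw [show pos n D U v + (n + 3) - pos n D U a = pos n D U v - pos n D U a + (n + 3) by omega,
      Nat.add_mod_right, Nat.mod_eq_of_lt (by omega)]
  · exact Nat.mod_eq_of_lt (by omega)

theorem strictBetween_iff (hUD : D ∪ U = Finset.Icc 1 (n + 1)) (hdisj : Disjoint D U)
    {a b v : ℕ} (ha : a ≤ n + 2) (hb : b ≤ n + 2) :
    StrictBetween n D U a b v ↔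
      v ≤ n + 2 ∧ CycBetween (pos n D U a) (pos n D U v) (pos n D U b) := by
  unfold StrictBetween CycBetween
  refine and_congr_right fun hv => ?_
  have h1 := pos_lt hUD hdisj ha
  have h2 := pos_lt hUD hdisj hv
  have h3 := pos_lt hUD hdisj hb
  rw [relpos_eq hUD hdisj ha hv, relpos_eq hUD hdisj ha hb]
  split_ifs <;> omega

theorem pos_lt_pos_iff (hUD : D ∪ U = Finset.Icc 1 (n + 1)) (hdisj : Disjoint D U)
    {v w : ℕ} (hv : v ≤ n + 2) (hw : w ≤ n + 2) :
    pos n D U v < pos n D U w ↔ (v < w ∧ v ∉ U) ∨ (w < v ∧ w ∈ U) := by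
  rcases lt_trichotomy v w with h | rfl | h
  · by_cases hU : v ∈ U
    · have := pos_lt_pos_of_mem hUD hdisj h hw hU
      simp only [hU, not_true_eq_false, and_false, false_or]
      omega
    · have := pos_lt_pos_of_notMem hUD h hw hU
      simp only [hU, not_false_eq_true, and_true]
      omega
  · simp
  · by_cases hU : w ∈ U
    · have := pos_lt_pos_of_mem hUD hdisj h hv hU
      simp only [hU, and_true]
      omega
    · have := pos_lt_pos_of_notMem hUD h hv hU
      simp only [hU, and_false, or_false]
      omega

theorem pos_injOn (hUD : D ∪ U = Finset.Icc 1 (n + 1)) (hdisj : Disjoint D U)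
    {v w : ℕ} (hv : v ≤ n + 2) (hw : w ≤ n + 2) (h : pos n D U v = pos n D U w) : v = w := by
  have h1 := pos_lt_pos_iff hUD hdisj hv hw
  have h2 := pos_lt_pos_iff hUD hdisj hw hv
  rw [h] at h1 h2
  simp only [lt_irrefl, false_iff] at h1 h2
  by_cases hvU : v ∈ U <;> by_cases hwU : w ∈ U <;> simp [hvU, hwU] at h1 h2 <;> omega

theorem exists_pos_eq (hUD : D ∪ U = Finset.Icc 1 (n + 1)) (hdisj : Disjoint D U)
    {p : ℕ} (hp : p < n + 3) : ∃ v ≤ n + 2, pos n D U v = p := by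
  have h := Finset.surjOn_of_injOn_of_card_le (s := Finset.range (n + 3))
    (t := Finset.range (n + 3)) (pos n D U)
    (fun v hv => by
      simp only [Finset.coe_range, Set.mem_Iio] at hv ⊢
      exact pos_lt hUD hdisj (by omega))
    (fun v hv w hw h => by
      simp only [Finset.coe_range, Set.mem_Iio] at hv hw
      exact pos_injOn hUD hdisj (by omega) (by omega) h) le_rfl
  obtain ⟨v, hv, rfl⟩ := h (by simpa using hp)
  simp only [Finset.coe_range, Set.mem_Iio] at hv
  exact ⟨v, by omega, rfl⟩

/-- `v` lies below the diagonal `{a, b}`, or is one of its endpoints and belongs to `U`. -/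
def Below (U : Finset ℕ) (a b v : ℕ) : Prop :=
  v ≤ a ∧ a ∈ U ∨ b ≤ v ∧ b ∈ U ∨ a < v ∧ v < b ∧ v ∉ U

theorem strictBetween_iff_below (hUD : D ∪ U = Finset.Icc 1 (n + 1)) (hdisj : Disjoint D U)
    {a b v : ℕ} (hab : a < b) (hb : b ≤ n + 2) :
    StrictBetween n D U a b v ↔ v ≤ n + 2 ∧ v ≠ a ∧ v ≠ b ∧ Below U a b v := by
  rw [strictBetween_iff hUD hdisj (by omega) hb]
  refine and_congr_right fun hv => ?_
  unfold CycBetween Below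
  rw [pos_lt_pos_iff hUD hdisj (by omega) hv, pos_lt_pos_iff hUD hdisj hv hb,
    pos_lt_pos_iff hUD hdisj hb (by omega)]
  have hva : v = a → (v ∈ U ↔ a ∈ U) := by rintro rfl; rfl
  have hvb : v = b → (v ∈ U ↔ b ∈ U) := by rintro rfl; rfl
  by_cases haU : a ∈ U <;> by_cases hbU : b ∈ U <;> by_cases hvU : v ∈ U <;>
    simp only [haU, hbU, hvU, not_true_eq_false, not_false_eq_true, and_true, and_false, or_false,
      false_or, or_self, iff_true, iff_false, imp_false, false_and, ne_eq] at hva hvb ⊢ <;> omega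

theorem strictBetween_iff_not_below (hUD : D ∪ U = Finset.Icc 1 (n + 1)) (hdisj : Disjoint D U)
    {a b v : ℕ} (hab : a < b) (hb : b ≤ n + 2) :
    StrictBetween n D U b a v ↔ v ≤ n + 2 ∧ v ≠ a ∧ v ≠ b ∧ ¬ Below U a b v := by
  rw [strictBetween_iff hUD hdisj hb (by omega)]
  refine and_congr_right fun hv => ?_
  unfold CycBetween Below
  rw [pos_lt_pos_iff hUD hdisj (by omega) hv, pos_lt_pos_iff hUD hdisj hv (by omega),
    pos_lt_pos_iff hUD hdisj (by omega) hb]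
  have hva : v = a → (v ∈ U ↔ a ∈ U) := by rintro rfl; rfl
  have hvb : v = b → (v ∈ U ↔ b ∈ U) := by rintro rfl; rfl
  by_cases haU : a ∈ U <;> by_cases hbU : b ∈ U <;> by_cases hvU : v ∈ U <;>
    simp only [haU, hbU, hvU, not_true_eq_false, not_false_eq_true, and_true, and_false, or_false,
      false_or, or_self, iff_true, iff_false, imp_false, false_and, ne_eq] at hva hvb ⊢ <;> omega

theorem mem_Bel (hUD : D ∪ U = Finset.Icc 1 (n + 1)) (hdisj : Disjoint D U)
    {a b j : ℕ} (hab : a < b) (hb : b ≤ n + 2) :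
    j ∈ Bel n D U (a, b) ↔ j ∈ Finset.Icc 1 (n + 1) ∧ Below U a b j := by
  unfold Bel
  rw [Finset.mem_filter, strictBetween_iff_below hUD hdisj hab hb]
  refine and_congr_right fun hj => ?_
  rw [Finset.mem_Icc] at hj
  unfold Below
  constructor
  · rintro (h | ⟨h, rfl | rfl⟩)
    · exact h.2.2.2
    · exact Or.inl ⟨le_rfl, h⟩
    · exact Or.inr (Or.inl ⟨le_rfl, h⟩)
  · intro h
    by_cases h1 : j = a
    · subst h1
      refine Or.inr ⟨?_, Or.inl rfl⟩
      rcases h with h | h | h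
      exacts [h.2, by omega, by omega]
    · by_cases h2 : j = b
      · subst h2
        refine Or.inr ⟨?_, Or.inr rfl⟩
        rcases h with h | h | h
        exacts [by omega, h.2, by omega]
      · exact Or.inl ⟨by omega, h1, h2, h⟩

end Positions

section Crossings

variable {n : ℕ} {D U : Finset ℕ}

theorem cross_iff_cycBetween (hUD : D ∪ U = Finset.Icc 1 (n + 1)) (hdisj : Disjoint D U)
    {a b c d : ℕ} (ha : a ≤ n + 2) (hb : b ≤ n + 2) (hc : c ≤ n + 2) (hd : d ≤ n + 2) :
    Cross n D U (a, b) (c, d) ↔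
      CycBetween (pos n D U a) (pos n D U c) (pos n D U b) ∧
        CycBetween (pos n D U b) (pos n D U d) (pos n D U a) ∨
      CycBetween (pos n D U a) (pos n D U d) (pos n D U b) ∧
        CycBetween (pos n D U b) (pos n D U c) (pos n D U a) := by
  simp only [Cross, strictBetween_iff hUD hdisj ha hb, strictBetween_iff hUD hdisj hb ha, hc, hd,
    true_and]
  constructor
  · exact fun h => h.2.2.2.2.2.2
  · intro h
    refine ⟨?_, ?_, ?_, ?_, ?_, ?_, h⟩ <;> rintro rfl <;> unfold CycBetween at h <;> omega

theorem cross_comm (hUD : D ∪ U = Finset.Icc 1 (n + 1)) (hdisj : Disjoint D U)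
    {δ δ' : ℕ × ℕ} (h : IsDiag n δ) (h' : IsDiag n δ') :
    Cross n D U δ δ' ↔ Cross n D U δ' δ := by
  obtain ⟨a, b⟩ := δ
  obtain ⟨c, d⟩ := δ'
  simp only [IsDiag] at h h'
  rw [cross_iff_cycBetween hUD hdisj (by omega) h.2 (by omega) h'.2,
    cross_iff_cycBetween hUD hdisj (by omega) h'.2 (by omega) h.2]
  unfold CycBetween
  omega

theorem cross_iff_below (hUD : D ∪ U = Finset.Icc 1 (n + 1)) (hdisj : Disjoint D U)
    {a b c d : ℕ} (hab : a < b) (hb : b ≤ n + 2) (hcd : c < d) (hd : d ≤ n + 2) :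
    Cross n D U (a, b) (c, d) ↔ a ≠ c ∧ a ≠ d ∧ b ≠ c ∧ b ≠ d ∧
      (Below U a b c ↔ ¬ Below U a b d) := by
  have hc : c ≤ n + 2 := by omega
  simp only [Cross, strictBetween_iff_below hUD hdisj hab hb,
    strictBetween_iff_not_below hUD hdisj hab hb, hc, hd, true_and]
  grind

theorem not_cross_of_isBoundaryEdge {δ δ' : ℕ × ℕ} (h : IsBoundaryEdge n D U δ) :
    ¬ Cross n D U δ δ' := by
  unfold Cross StrictBetween
  have := h.2
  omega

theorem Cross.fst_lt_snd (hUD : D ∪ U = Finset.Icc 1 (n + 1)) (hdisj : Disjoint D U)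
    {a b c d : ℕ} (hab : a < b) (hb : b ≤ n + 2) (hcd : c < d) (hd : d ≤ n + 2)
    (h : Cross n D U (a, b) (c, d)) : a < d ∧ c < b := by
  rw [cross_iff_below hUD hdisj hab hb hcd hd] at h
  unfold Below at h
  grind

/-- Exchanging the right endpoints of two crossing diagonals yields the diagonals whose `Bel` sets
are the intersection and the union of the original ones. -/
theorem Cross.below_exchange (hUD : D ∪ U = Finset.Icc 1 (n + 1)) (hdisj : Disjoint D U)
    {a b c d : ℕ} (hab : a < b) (hb : b ≤ n + 2) (hcd : c < d) (hd : d ≤ n + 2)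
    (h : Cross n D U (a, b) (c, d)) :
    (∀ j, (Below U a d j ↔ Below U a b j ∧ Below U c d j) ∧
      (Below U c b j ↔ Below U a b j ∨ Below U c d j)) ∨
    (∀ j, (Below U a d j ↔ Below U a b j ∨ Below U c d j) ∧
      (Below U c b j ↔ Below U a b j ∧ Below U c d j)) := by
  have hlt := h.fst_lt_snd hUD hdisj hab hb hcd hd
  rw [cross_iff_below hUD hdisj hab hb hcd hd] at h
  unfold Below at h ⊢
  by_cases haU : a ∈ U <;> by_cases hbU : b ∈ U <;> by_cases hcU : c ∈ U <;>
    by_cases hdU : d ∈ U <;> simp only [haU, hbU, hcU, hdU] at h ⊢ <;> grind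

theorem Cross.exists_below_not_below (hUD : D ∪ U = Finset.Icc 1 (n + 1)) (hdisj : Disjoint D U)
    {a b c d : ℕ} (hab : a < b) (hb : b ≤ n + 2) (hcd : c < d) (hd : d ≤ n + 2)
    (h : Cross n D U (a, b) (c, d)) :
    ∃ j ∈ Finset.Icc 1 (n + 1), Below U a b j ∧ ¬ Below U c d j := by
  have hU : ∀ j ∈ U, 1 ≤ j ∧ j ≤ n + 1 := fun j hj => (mem_or_mem hUD).1 (Or.inr hj)
  have hlt := h.fst_lt_snd hUD hdisj hab hb hcd hd
  rw [cross_iff_below hUD hdisj hab hb hcd hd] at h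
  simp only [Finset.mem_Icc]
  unfold Below at h ⊢
  have ha := hU a
  have hb := hU b
  have hc := hU c
  have hd := hU d
  rcases lt_trichotomy a c with h1 | h1 | h1
  · rcases lt_trichotomy b d with h2 | h2 | h2
    · by_cases hcU : c ∈ U
      · exact ⟨b, by grind⟩
      · exact ⟨c, by grind⟩
    · grind
    · by_cases hcU : c ∈ U
      · exact ⟨d, by grind⟩
      · exact ⟨c, by grind⟩
  · grind
  · rcases lt_trichotomy b d with h2 | h2 | h2
    · by_cases haU : a ∈ U
      · exact ⟨a, by grind⟩
      · exact ⟨b, by grind⟩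
    · grind
    · by_cases haU : a ∈ U
      · exact ⟨a, by grind⟩
      · exact ⟨d, by grind⟩

theorem cycBetween_exchange {a b c d e f : ℕ}
    (h : CycBetween a c b ∧ CycBetween b d a ∨ CycBetween a d b ∧ CycBetween b c a)
    (hnc : ¬ (CycBetween c e d ∧ CycBetween d f c ∨ CycBetween c f d ∧ CycBetween d e c))
    (hex : CycBetween a e d ∧ CycBetween d f a ∨ CycBetween a f d ∧ CycBetween d e a) :
    CycBetween a e b ∧ CycBetween b f a ∨ CycBetween a f b ∧ CycBetween b e a := by
  unfold CycBetween at *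
  rcases h with ⟨h1, h2⟩ | ⟨h1, h2⟩ <;> rcases hex with ⟨h3, h4⟩ | ⟨h3, h4⟩ <;>
    rcases h1 with h1 | h1 | h1 <;> rcases h2 with h2 | h2 | h2 <;>
    rcases h3 with h3 | h3 | h3 <;> rcases h4 with h4 | h4 | h4 <;> omega

/-- A diagonal crossing a side of the quadrilateral spanned by two crossing diagonals, but not the
second of these, crosses the first. -/
theorem Cross.of_cross_exchange (hUD : D ∪ U = Finset.Icc 1 (n + 1)) (hdisj : Disjoint D U)
    {a b c d e f : ℕ} (ha : a ≤ n + 2) (hb : b ≤ n + 2) (hc : c ≤ n + 2) (hd : d ≤ n + 2)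
    (he : e ≤ n + 2) (hf : f ≤ n + 2) (h : Cross n D U (a, b) (c, d))
    (hnc : ¬ Cross n D U (c, d) (e, f))
    (hex : Cross n D U (a, d) (e, f) ∨ Cross n D U (c, b) (e, f)) :
    Cross n D U (a, b) (e, f) := by
  rw [cross_iff_cycBetween hUD hdisj ha hb hc hd] at h
  rw [cross_iff_cycBetween hUD hdisj hc hd he hf] at hnc
  rw [cross_iff_cycBetween hUD hdisj ha hd he hf, cross_iff_cycBetween hUD hdisj hc hb he hf] at hex
  rw [cross_iff_cycBetween hUD hdisj ha hb he hf]
  rcases hex with hex | hex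
  · exact cycBetween_exchange h hnc hex
  · have := @cycBetween_exchange (pos n D U b) (pos n D U a) (pos n D U d) (pos n D U c)
      (pos n D U e) (pos n D U f) (by tauto) (by tauto) (by tauto)
    tauto

end Crossings

section Triangulations

variable {n : ℕ} {D U : Finset ℕ} {T : Finset (ℕ × ℕ)}

/-- `a` and `b`, in either order, are joined by a diagonal of `T` or a boundary edge. -/
def Joined (n : ℕ) (D U : Finset ℕ) (T : Finset (ℕ × ℕ)) (a b : ℕ) : Prop :=
  a < b ∧ EdgeOf n D U T a b ∨ b < a ∧ EdgeOf n D U T b a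

theorem Joined.symm {a b : ℕ} (h : Joined n D U T a b) : Joined n D U T b a :=
  Or.symm h

theorem IsTriangulation.edgeOf_of_not_cross (hT : IsTriangulation n D U T) {a b : ℕ}
    (hab : a < b) (hb : b ≤ n + 2) (h : ∀ δ ∈ T, ¬ Cross n D U (a, b) δ) :
    EdgeOf n D U T a b := by
  unfold EdgeOf
  by_contra! hc
  obtain ⟨δ, hδ, hcr⟩ := hT.2.2 (a, b) ⟨⟨hab, hb⟩, hc.2⟩ hc.1
  exact h δ hδ hcr

theorem IsTriangulation.not_cross_of_edgeOf (hUD : D ∪ U = Finset.Icc 1 (n + 1))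
    (hdisj : Disjoint D U) (hT : IsTriangulation n D U T) {a b c d : ℕ} (hab : a < b)
    (hb : b ≤ n + 2) (hcd : c < d) (hd : d ≤ n + 2)
    (h : EdgeOf n D U T a b) (h' : EdgeOf n D U T c d) : ¬ Cross n D U (a, b) (c, d) := by
  rcases h' with h' | h'
  · rcases h with h | h
    · exact hT.2.1 _ h _ h'
    · exact not_cross_of_isBoundaryEdge h
  · rw [cross_comm hUD hdisj ⟨hab, hb⟩ ⟨hcd, hd⟩]
    exact not_cross_of_isBoundaryEdge h'

theorem IsTriangulation.not_cycBetween (hUD : D ∪ U = Finset.Icc 1 (n + 1))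
    (hdisj : Disjoint D U) (hT : IsTriangulation n D U T) {a b c d : ℕ} (ha : a ≤ n + 2)
    (hb : b ≤ n + 2) (hc : c ≤ n + 2) (hd : d ≤ n + 2)
    (h : Joined n D U T a b) (h' : Joined n D U T c d) :
    ¬ (CycBetween (pos n D U a) (pos n D U c) (pos n D U b) ∧
      CycBetween (pos n D U b) (pos n D U d) (pos n D U a)) := by
  rcases h with ⟨h1, h2⟩ | ⟨h1, h2⟩ <;> rcases h' with ⟨h3, h4⟩ | ⟨h3, h4⟩ <;>
  · have := hT.not_cross_of_edgeOf hUD hdisj h1 (by assumption) h3 (by assumption) h2 h4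
    rw [cross_iff_cycBetween hUD hdisj (by assumption) (by assumption) (by assumption)
      (by assumption)] at this
    tauto

theorem IsTriangulation.exists_cycBetween (hUD : D ∪ U = Finset.Icc 1 (n + 1))
    (hdisj : Disjoint D U) (hT : IsTriangulation n D U T) {a b : ℕ} (ha : a ≤ n + 2)
    (hb : b ≤ n + 2) (hab : a ≠ b) (h : ¬ Joined n D U T a b) :
    ∃ c d, c ≤ n + 2 ∧ d ≤ n + 2 ∧ Joined n D U T c d ∧
      CycBetween (pos n D U a) (pos n D U c) (pos n D U b) ∧
      CycBetween (pos n D U b) (pos n D U d) (pos n D U a) := by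
  unfold Joined at h
  push Not at h
  have key : ∃ c d, c < d ∧ d ≤ n + 2 ∧ (c, d) ∈ T ∧
      (CycBetween (pos n D U a) (pos n D U c) (pos n D U b) ∧
        CycBetween (pos n D U b) (pos n D U d) (pos n D U a) ∨
      CycBetween (pos n D U a) (pos n D U d) (pos n D U b) ∧
        CycBetween (pos n D U b) (pos n D U c) (pos n D U a)) := by
    rcases lt_or_gt_of_ne hab with hlt | hlt
    · by_contra! hc
      refine h.1 hlt (hT.edgeOf_of_not_cross hlt hb fun ⟨c, d⟩ hδ => ?_)
      obtain ⟨hcd : c < d, hd : d ≤ n + 2⟩ := (hT.1 _ hδ).1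
      rw [cross_iff_cycBetween hUD hdisj ha hb (by omega) hd]
      have := hc c d hcd hd hδ
      tauto
    · by_contra! hc
      refine h.2 hlt (hT.edgeOf_of_not_cross hlt ha fun ⟨c, d⟩ hδ => ?_)
      obtain ⟨hcd : c < d, hd : d ≤ n + 2⟩ := (hT.1 _ hδ).1
      rw [cross_iff_cycBetween hUD hdisj hb ha (by omega) hd]
      have := hc c d hcd hd hδ
      tauto
  obtain ⟨c, d, hcd, hd, hmem, hcr | hcr⟩ := key
  · exact ⟨c, d, by omega, hd, Or.inl ⟨hcd, Or.inl hmem⟩, hcr⟩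
  · exact ⟨d, c, hd, by omega, Or.inr ⟨hcd, Or.inl hmem⟩, hcr⟩

theorem exists_relpos_eq_one (hUD : D ∪ U = Finset.Icc 1 (n + 1)) (hdisj : Disjoint D U)
    {a : ℕ} (ha : a ≤ n + 2) : ∃ c ≤ n + 2, relpos n D U a c = 1 := by
  have hp := pos_lt hUD hdisj ha
  by_cases h : pos n D U a = n + 2
  · obtain ⟨c, hc, hpc⟩ := exists_pos_eq hUD hdisj (p := 0) (by omega)
    refine ⟨c, hc, ?_⟩
    rw [relpos_eq hUD hdisj ha hc, hpc, h, if_neg (by omega)]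
    omega
  · obtain ⟨c, hc, hpc⟩ := exists_pos_eq hUD hdisj (p := pos n D U a + 1) (by omega)
    refine ⟨c, hc, ?_⟩
    rw [relpos_eq hUD hdisj ha hc, hpc, if_pos (by omega)]
    omega

theorem joined_of_relpos_eq_one {a c : ℕ} (ha : a ≤ n + 2) (hc : c ≤ n + 2)
    (h : relpos n D U a c = 1) : Joined n D U T a c := by
  rcases lt_trichotomy a c with h1 | rfl | h1
  · exact Or.inl ⟨h1, Or.inr ⟨⟨h1, hc⟩, Or.inl h⟩⟩
  · simp [relpos] at h
  · exact Or.inr ⟨h1, Or.inr ⟨⟨h1, ha⟩, Or.inr h⟩⟩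

theorem CycBetween.eq_of_not_cross {a b c p q : ℕ} (h : CycBetween a c b) (h1 : CycBetween c p b)
    (h2 : CycBetween b q c) (n1 : ¬ (CycBetween a p b ∧ CycBetween b q a))
    (n2 : ¬ (CycBetween a q c ∧ CycBetween c p a)) : q = a := by
  unfold CycBetween at *
  rcases h with h | h | h <;> rcases h1 with h1 | h1 | h1 <;> rcases h2 with h2 | h2 | h2 <;> omega

/-- A nonempty side of an edge of a triangulation contains a triangle at that edge. -/
theorem IsTriangulation.exists_triangle (hUD : D ∪ U = Finset.Icc 1 (n + 1))
    (hdisj : Disjoint D U) (hT : IsTriangulation n D U T) {a b v : ℕ} (ha : a ≤ n + 2)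
    (hb : b ≤ n + 2) (hab : Joined n D U T a b) (hv : StrictBetween n D U a b v) :
    ∃ c, StrictBetween n D U a b c ∧ Joined n D U T a c ∧ Joined n D U T c b := by
  let s := (Finset.range (n + 3)).filter
    (fun c => StrictBetween n D U a b c ∧ Joined n D U T a c)
  have hs : s.Nonempty := by
    obtain ⟨c, hc, h1⟩ := exists_relpos_eq_one hUD hdisj ha
    refine ⟨c, Finset.mem_filter.2 ⟨Finset.mem_range.2 (by omega), ⟨hc, by omega, ?_⟩,
      joined_of_relpos_eq_one ha hc h1⟩⟩
    have := hv.2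
    omega
  obtain ⟨c, hcs, hmax⟩ := s.exists_max_image (relpos n D U a) hs
  obtain ⟨-, hc, hac⟩ := Finset.mem_filter.1 hcs
  refine ⟨c, hc, hac, ?_⟩
  by_contra hcb
  obtain ⟨hcn, hcyc⟩ := (strictBetween_iff hUD hdisj ha hb).1 hc
  have hne : c ≠ b := by
    rintro rfl
    exact lt_irrefl _ hc.2.2
  obtain ⟨p, q, hp, hq, hpq, h1, h2⟩ := hT.exists_cycBetween hUD hdisj hcn hb hne hcb
  have n1 := hT.not_cycBetween hUD hdisj ha hb hp hq hab hpq
  have n2 := hT.not_cycBetween hUD hdisj ha hcn hq hp hac hpq.symm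
  have hqa : pos n D U q = pos n D U a := hcyc.eq_of_not_cross h1 h2 n1 n2
  obtain rfl := pos_injOn hUD hdisj hq ha hqa
  have hpm : p ∈ s := by
    refine Finset.mem_filter.2 ⟨Finset.mem_range.2 (by omega), ?_, hpq.symm⟩
    rw [strictBetween_iff hUD hdisj ha hb]
    refine ⟨hp, ?_⟩
    clear n1 n2
    unfold CycBetween at *
    omega
  have hle := hmax p hpm
  have hlc := pos_lt hUD hdisj hcn
  have hlp := pos_lt hUD hdisj hp
  have hla := pos_lt hUD hdisj ha
  rw [relpos_eq hUD hdisj ha hp, relpos_eq hUD hdisj ha hcn] at hle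
  clear n1 n2 h2
  unfold CycBetween at *
  split_ifs at hle <;> omega

theorem IsTriangulation.triangle_unique (hUD : D ∪ U = Finset.Icc 1 (n + 1))
    (hdisj : Disjoint D U) (hT : IsTriangulation n D U T) {i j k i' k' : ℕ}
    (h : IsTriangleOf n D U T i j k) (h' : IsTriangleOf n D U T i' j k') : i = i' ∧ k = k' := by
  obtain ⟨hij, hjk, hk, e1, e2, e3⟩ := h
  obtain ⟨hij', hjk', hk', e1', e2', e3'⟩ := h'
  have c1 := hT.not_cross_of_edgeOf hUD hdisj (hij.trans hjk) hk hij' (by omega) e3 e1'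
  have c2 := hT.not_cross_of_edgeOf hUD hdisj (hij.trans hjk) hk hjk' (by omega) e3 e2'
  have c3 := hT.not_cross_of_edgeOf hUD hdisj (hij'.trans hjk') hk' hij (by omega) e3' e1
  have c4 := hT.not_cross_of_edgeOf hUD hdisj (hij'.trans hjk') hk' hjk (by omega) e3' e2
  rw [cross_iff_below hUD hdisj (by omega) (by omega) (by omega) (by omega)] at c1 c2 c3 c4
  have hi : i = i' → (i ∈ U ↔ i' ∈ U) := by rintro rfl; rfl
  have hk : k = k' → (k ∈ U ↔ k' ∈ U) := by rintro rfl; rfl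
  unfold Below at c1 c2 c3 c4
  clear e1 e2 e3 e1' e2' e3' hT hUD hdisj
  by_cases hiU : i ∈ U <;> by_cases hjU : j ∈ U <;> by_cases hkU : k ∈ U <;>
    by_cases hiU' : i' ∈ U <;> by_cases hkU' : k' ∈ U <;>
    simp only [hiU, hjU, hkU, hiU', hkU', not_true_eq_false, not_false_eq_true, and_true,
      and_false, or_false, false_or, iff_false, iff_true, imp_false, false_iff]
      at c1 c2 c3 c4 hi hk <;>
    omega

end Triangulations

section Sums

variable {n : ℕ} {D U : Finset ℕ}

theorem sum_Bel (hUD : D ∪ U = Finset.Icc 1 (n + 1)) (hdisj : Disjoint D U) (x : ℕ → ℝ)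
    {a b : ℕ} (hab : a < b) (hb : b ≤ n + 2) :
    ∑ j ∈ Bel n D U (a, b), x j = ∑ j ∈ Finset.Icc 1 (n + 1), if Below U a b j then x j else 0 := by
  rw [← Finset.sum_filter]
  refine Finset.sum_congr ?_ fun _ _ => rfl
  ext j
  rw [mem_Bel hUD hdisj hab hb, Finset.mem_filter]

theorem bel_eq_sum (n : ℕ) (D U : Finset ℕ) (δ : ℕ × ℕ) :
    (bel n D U δ : ℝ) = ∑ _j ∈ Bel n D U δ, (1 : ℝ) := by
  simp [bel]

theorem sum_Bel_of_notMem (hUD : D ∪ U = Finset.Icc 1 (n + 1)) (hdisj : Disjoint D U)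
    (x : ℕ → ℝ) {i j k : ℕ} (hij : i < j) (hjk : j < k) (hk : k ≤ n + 2) (hj : j ∉ U) :
    ∑ l ∈ Bel n D U (i, k), x l
      = ∑ l ∈ Bel n D U (i, j), x l + ∑ l ∈ Bel n D U (j, k), x l + x j := by
  have hjI : j ∈ Finset.Icc 1 (n + 1) := Finset.mem_Icc.2 ⟨by omega, by omega⟩
  rw [sum_Bel hUD hdisj x (hij.trans hjk) hk, sum_Bel hUD hdisj x hij (by omega),
    sum_Bel hUD hdisj x hjk hk, ← Finset.sum_ite_eq_of_mem' _ j x hjI,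
    ← Finset.sum_add_distrib, ← Finset.sum_add_distrib]
  refine Finset.sum_congr rfl fun l _ => ?_
  unfold Below
  grind

theorem sum_Bel_of_mem (hUD : D ∪ U = Finset.Icc 1 (n + 1)) (hdisj : Disjoint D U)
    (x : ℕ → ℝ) {i j k : ℕ} (hij : i < j) (hjk : j < k) (hk : k ≤ n + 2) (hj : j ∈ U) :
    ∑ l ∈ Bel n D U (i, j), x l + ∑ l ∈ Bel n D U (j, k), x l
      = ∑ l ∈ Bel n D U (i, k), x l + ∑ l ∈ Finset.Icc 1 (n + 1), x l + x j := by
  have hjI : j ∈ Finset.Icc 1 (n + 1) := Finset.mem_Icc.2 ⟨by omega, by omega⟩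
  rw [sum_Bel hUD hdisj x (hij.trans hjk) hk, sum_Bel hUD hdisj x hij (by omega),
    sum_Bel hUD hdisj x hjk hk, ← Finset.sum_ite_eq_of_mem' _ j x hjI,
    ← Finset.sum_add_distrib, ← Finset.sum_add_distrib, ← Finset.sum_add_distrib]
  refine Finset.sum_congr rfl fun l _ => ?_
  unfold Below
  grind

theorem Cross.Bel_exchange (hUD : D ∪ U = Finset.Icc 1 (n + 1)) (hdisj : Disjoint D U)
    {a b c d : ℕ} (hab : a < b) (hb : b ≤ n + 2) (hcd : c < d) (hd : d ≤ n + 2)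
    (h : Cross n D U (a, b) (c, d)) :
    (Bel n D U (a, d) = Bel n D U (a, b) ∩ Bel n D U (c, d) ∧
      Bel n D U (c, b) = Bel n D U (a, b) ∪ Bel n D U (c, d)) ∨
    (Bel n D U (a, d) = Bel n D U (a, b) ∪ Bel n D U (c, d) ∧
      Bel n D U (c, b) = Bel n D U (a, b) ∩ Bel n D U (c, d)) := by
  obtain ⟨had, hcb⟩ := h.fst_lt_snd hUD hdisj hab hb hcd hd
  refine (h.below_exchange hUD hdisj hab hb hcd hd).imp (fun hj => ⟨?_, ?_⟩)
    (fun hj => ⟨?_, ?_⟩) <;> ext j <;> have := hj j <;>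
    simp only [Finset.mem_inter, Finset.mem_union, mem_Bel hUD hdisj hab hb,
      mem_Bel hUD hdisj hcd hd, mem_Bel hUD hdisj had hd, mem_Bel hUD hdisj hcb hb] <;> tauto

theorem Cross.sum_Bel_exchange (hUD : D ∪ U = Finset.Icc 1 (n + 1)) (hdisj : Disjoint D U)
    (x : ℕ → ℝ) {a b c d : ℕ} (hab : a < b) (hb : b ≤ n + 2) (hcd : c < d) (hd : d ≤ n + 2)
    (h : Cross n D U (a, b) (c, d)) :
    ∑ j ∈ Bel n D U (a, d), x j + ∑ j ∈ Bel n D U (c, b), x j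
      = ∑ j ∈ Bel n D U (a, b), x j + ∑ j ∈ Bel n D U (c, d), x j := by
  rcases h.Bel_exchange hUD hdisj hab hb hcd hd with ⟨h1, h2⟩ | ⟨h1, h2⟩ <;> rw [h1, h2]
  · rw [add_comm, Finset.sum_union_inter]
  · rw [Finset.sum_union_inter]

/-- Supermodularity of `δ ↦ bel δ * (bel δ + 1) / 2` on crossing diagonals. -/
theorem Cross.bel_mul_bel_lt (hUD : D ∪ U = Finset.Icc 1 (n + 1)) (hdisj : Disjoint D U)
    {a b c d : ℕ} (hab : a < b) (hb : b ≤ n + 2) (hcd : c < d) (hd : d ≤ n + 2)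
    (h : Cross n D U (a, b) (c, d)) :
    ((bel n D U (a, b) : ℝ) + 1) * bel n D U (a, b) / 2
        + ((bel n D U (c, d) : ℝ) + 1) * bel n D U (c, d) / 2
      < ((bel n D U (a, d) : ℝ) + 1) * bel n D U (a, d) / 2
        + ((bel n D U (c, b) : ℝ) + 1) * bel n D U (c, b) / 2 := by
  have hIA : (Bel n D U (a, b) ∩ Bel n D U (c, d)).card < (Bel n D U (a, b)).card := by
    obtain ⟨j, hj, h1, h2⟩ := h.exists_below_not_below hUD hdisj hab hb hcd hd
    refine Finset.card_lt_card (Finset.ssubset_iff_of_subset Finset.inter_subset_left |>.2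
      ⟨j, (mem_Bel hUD hdisj hab hb).2 ⟨hj, h1⟩, fun hm => h2 ?_⟩)
    exact ((mem_Bel hUD hdisj hcd hd).1 (Finset.mem_inter.1 hm).2).2
  have hIB : (Bel n D U (a, b) ∩ Bel n D U (c, d)).card < (Bel n D U (c, d)).card := by
    obtain ⟨j, hj, h1, h2⟩ := ((cross_comm hUD hdisj ⟨hab, hb⟩ ⟨hcd, hd⟩).1 h).exists_below_not_below
      hUD hdisj hcd hd hab hb
    refine Finset.card_lt_card (Finset.ssubset_iff_of_subset Finset.inter_subset_right |>.2
      ⟨j, (mem_Bel hUD hdisj hcd hd).2 ⟨hj, h1⟩, fun hm => h2 ?_⟩)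
    exact ((mem_Bel hUD hdisj hab hb).1 (Finset.mem_inter.1 hm).1).2
  have hsum := Finset.card_union_add_card_inter (Bel n D U (a, b)) (Bel n D U (c, d))
  have hA : ((Bel n D U (a, b) ∩ Bel n D U (c, d)).card : ℝ) < (Bel n D U (a, b)).card := by
    exact_mod_cast hIA
  have hB : ((Bel n D U (a, b) ∩ Bel n D U (c, d)).card : ℝ) < (Bel n D U (c, d)).card := by
    exact_mod_cast hIB
  have hS : ((Bel n D U (a, b) ∪ Bel n D U (c, d)).card : ℝ)
      = (Bel n D U (a, b)).card + (Bel n D U (c, d)).card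
        - (Bel n D U (a, b) ∩ Bel n D U (c, d)).card := by
    rw [eq_sub_iff_add_eq]
    exact_mod_cast hsum
  have hpos := mul_pos (sub_pos.2 hA) (sub_pos.2 hB)
  unfold bel
  rcases h.Bel_exchange hUD hdisj hab hb hcd hd with ⟨h1, h2⟩ | ⟨h1, h2⟩ <;> rw [h1, h2, hS] <;>
    nlinarith

/-- The slack of the defining inequality of a diagonal. -/
def excess (n : ℕ) (D U : Finset ℕ) (x : ℕ → ℝ) (δ : ℕ × ℕ) : ℝ :=
  ∑ j ∈ Bel n D U δ, x j - ((bel n D U δ : ℝ) + 1) * bel n D U δ / 2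

def totalExcess (n : ℕ) (x : ℕ → ℝ) : ℝ :=
  ∑ j ∈ Finset.Icc 1 (n + 1), x j - ((n : ℝ) + 2) * ((n : ℝ) + 1) / 2

theorem Cross.excess_exchange_lt (hUD : D ∪ U = Finset.Icc 1 (n + 1)) (hdisj : Disjoint D U)
    (x : ℕ → ℝ) {a b c d : ℕ} (hab : a < b) (hb : b ≤ n + 2) (hcd : c < d) (hd : d ≤ n + 2)
    (h : Cross n D U (a, b) (c, d)) :
    excess n D U x (a, d) + excess n D U x (c, b)
      < excess n D U x (a, b) + excess n D U x (c, d) := by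
  have h1 := h.bel_mul_bel_lt hUD hdisj hab hb hcd hd
  have h2 := h.sum_Bel_exchange hUD hdisj x hab hb hcd hd
  unfold excess
  linarith

theorem Bel_eq_empty (hUD : D ∪ U = Finset.Icc 1 (n + 1)) (hdisj : Disjoint D U) {a b : ℕ}
    (hab : a < b) (hb : b ≤ n + 2) (h : ∀ v, ¬ StrictBetween n D U a b v) :
    Bel n D U (a, b) = ∅ := by
  have key : ∀ v ≤ n + 2, Below U a b v → v = a ∨ v = b := by
    intro v hv hv'
    by_contra! hc
    exact h v ((strictBetween_iff_below hUD hdisj hab hb).2 ⟨hv, hc.1, hc.2, hv'⟩)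
  have k0 := key 0 (by omega)
  have k1 := key (n + 2) le_rfl
  have ha : a ∈ U → 1 ≤ a := fun hu => ((mem_or_mem hUD).1 (Or.inr hu)).1
  have hb' : b ∈ U → b ≤ n + 1 := fun hu => ((mem_or_mem hUD).1 (Or.inr hu)).2
  refine Finset.eq_empty_of_forall_notMem fun j hj => ?_
  obtain ⟨hjI, hj⟩ := (mem_Bel hUD hdisj hab hb).1 hj
  have kj := key j (by rw [Finset.mem_Icc] at hjI; omega) hj
  unfold Below at *
  grind

theorem Bel_eq_Icc (hUD : D ∪ U = Finset.Icc 1 (n + 1)) (hdisj : Disjoint D U) {a b : ℕ}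
    (hab : a < b) (hb : b ≤ n + 2) (h : ∀ v, ¬ StrictBetween n D U b a v) :
    Bel n D U (a, b) = Finset.Icc 1 (n + 1) := by
  have key : ∀ v ≤ n + 2, ¬ Below U a b v → v = a ∨ v = b := by
    intro v hv hv'
    by_contra! hc
    exact h v ((strictBetween_iff_not_below hUD hdisj hab hb).2 ⟨hv, hc.1, hc.2, hv'⟩)
  have k0 := key 0 (by omega)
  have k1 := key (n + 2) le_rfl
  ext j
  rw [mem_Bel hUD hdisj hab hb, and_iff_left_iff_imp]
  intro hjI
  by_contra hj
  have kj := key j (by rw [Finset.mem_Icc] at hjI; omega) hj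
  rw [Finset.mem_Icc] at hjI
  unfold Below at *
  grind

theorem excess_of_Bel_eq_empty {δ : ℕ × ℕ} (x : ℕ → ℝ) (h : Bel n D U δ = ∅) :
    excess n D U x δ = 0 := by
  simp [excess, bel, h]

theorem excess_of_Bel_eq_Icc {δ : ℕ × ℕ} (x : ℕ → ℝ) (h : Bel n D U δ = Finset.Icc 1 (n + 1)) :
    excess n D U x δ = totalExcess n x := by
  simp only [excess, totalExcess, bel, h, Nat.card_Icc]
  push_cast
  ring

end Sums

section Points

variable {n : ℕ} {D U : Finset ℕ} {T : Finset (ℕ × ℕ)}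

theorem IsTriangulation.xcoord_eq (hUD : D ∪ U = Finset.Icc 1 (n + 1)) (hdisj : Disjoint D U)
    (hT : IsTriangulation n D U T) {i j k : ℕ} (h : IsTriangleOf n D U T i j k) :
    xcoord n D U T j = if j ∈ D then
        ((bel n D U (i, j) : ℝ) + 1) * ((bel n D U (j, k) : ℝ) + 1)
      else ((n : ℝ) + 2) -
        (((n : ℝ) + 2) - (bel n D U (i, j) : ℝ)) * (((n : ℝ) + 2) - (bel n D U (j, k) : ℝ)) := by
  have hex : ∃ p : ℕ × ℕ, IsTriangleOf n D U T p.1 j p.2 := ⟨(i, k), h⟩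
  obtain ⟨h1, h2⟩ := hT.triangle_unique hUD hdisj hex.choose_spec h
  rw [xcoord, dif_pos hex, h1, h2]

theorem xcoord_of_notMem {j : ℕ} (hj : j ∉ Finset.Icc 1 (n + 1)) : xcoord n D U T j = 0 := by
  refine dif_neg ?_
  rintro ⟨⟨i, k⟩, h1, h2, h3, -⟩
  refine hj (Finset.mem_Icc.2 ⟨?_, ?_⟩) <;> simp only at h1 h2 h3 <;> omega

theorem IsTriangulation.excess_of_notMem (hUD : D ∪ U = Finset.Icc 1 (n + 1))
    (hdisj : Disjoint D U) (hT : IsTriangulation n D U T) {i j k : ℕ}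
    (h : IsTriangleOf n D U T i j k) (hj : j ∉ U) :
    excess n D U (xcoord n D U T) (i, k)
      = excess n D U (xcoord n D U T) (i, j) + excess n D U (xcoord n D U T) (j, k) := by
  have hjD : j ∈ D := ((mem_or_mem hUD).2
    ⟨by have := h.1; omega, by have := h.2.1; have := h.2.2.1; omega⟩).resolve_right hj
  have hx := hT.xcoord_eq hUD hdisj h
  rw [if_pos hjD] at hx
  have hs := sum_Bel_of_notMem hUD hdisj (xcoord n D U T) h.1 h.2.1 h.2.2.1 hj
  have hb := sum_Bel_of_notMem hUD hdisj 1 h.1 h.2.1 h.2.2.1 hj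
  simp only [Pi.one_apply, ← bel_eq_sum] at hb
  simp only [excess]
  rw [hs, hx, hb]
  ring

theorem IsTriangulation.excess_of_mem (hUD : D ∪ U = Finset.Icc 1 (n + 1))
    (hdisj : Disjoint D U) (hT : IsTriangulation n D U T) {i j k : ℕ}
    (h : IsTriangleOf n D U T i j k) (hj : j ∈ U) :
    excess n D U (xcoord n D U T) (i, j) + excess n D U (xcoord n D U T) (j, k)
      = excess n D U (xcoord n D U T) (i, k) + totalExcess n (xcoord n D U T) := by
  have hx := hT.xcoord_eq hUD hdisj h
  rw [if_neg fun hjD => Finset.disjoint_left.1 hdisj hjD hj] at hx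
  have hs := sum_Bel_of_mem hUD hdisj (xcoord n D U T) h.1 h.2.1 h.2.2.1 hj
  have hb := sum_Bel_of_mem hUD hdisj 1 h.1 h.2.1 h.2.2.1 hj
  simp only [Pi.one_apply, Finset.sum_const, Nat.card_Icc, nsmul_eq_mul,
    mul_one] at hb
  push_cast at hb
  have hb' : (bel n D U (i, k) : ℝ) = bel n D U (i, j) + bel n D U (j, k) - n - 2 := by
    unfold bel
    linarith
  simp only [excess, totalExcess]
  rw [eq_sub_of_add_eq hs, hx, hb']
  ring

/-- The excess on the counterclockwise side of the directed diagonal from `u` to `v`. -/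
def dirExcess (n : ℕ) (D U : Finset ℕ) (x : ℕ → ℝ) (u v : ℕ) : ℝ :=
  if u < v then excess n D U x (u, v) else totalExcess n x - excess n D U x (v, u)

theorem IsTriangulation.dirExcess_add (hUD : D ∪ U = Finset.Icc 1 (n + 1))
    (hdisj : Disjoint D U) (hT : IsTriangulation n D U T) {u v c : ℕ} (hu : u ≤ n + 2)
    (hv : v ≤ n + 2) (h : StrictBetween n D U u v c) (huv : Joined n D U T u v)
    (huc : Joined n D U T u c) (hcv : Joined n D U T c v) :
    dirExcess n D U (xcoord n D U T) u v
      = dirExcess n D U (xcoord n D U T) u c + dirExcess n D U (xcoord n D U T) c v := by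
  have hc := h.1
  unfold dirExcess
  rcases huv with ⟨h1, e1⟩ | ⟨h1, e1⟩ <;> rcases huc with ⟨h2, e2⟩ | ⟨h2, e2⟩ <;>
    rcases hcv with ⟨h3, e3⟩ | ⟨h3, e3⟩ <;> try omega
  all_goals
    first
    | rw [strictBetween_iff_below hUD hdisj h1 hv] at h
    | rw [strictBetween_iff_not_below hUD hdisj h1 hu] at h
    have hb := h.2.2.2
    unfold Below at hb
    simp only [h1, h2, h3, if_true, not_lt_of_gt, if_false]
  · have := hT.excess_of_notMem hUD hdisj ⟨h2, h3, hv, e2, e3, e1⟩ (by grind)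
    linarith
  · have := hT.excess_of_mem hUD hdisj ⟨h1, h3, hc, e1, e3, e2⟩ (by grind)
    linarith
  · have := hT.excess_of_mem hUD hdisj ⟨h2, h1, hv, e2, e1, e3⟩ (by grind)
    linarith
  · have := hT.excess_of_notMem hUD hdisj ⟨h1, h2, hc, e1, e2, e3⟩ (by grind)
    linarith
  · have := hT.excess_of_notMem hUD hdisj ⟨h3, h1, hu, e3, e1, e2⟩ (by grind)
    linarith
  · have := hT.excess_of_mem hUD hdisj ⟨h3, h2, hu, e3, e2, e1⟩ (by grind)
    linarith

theorem dirExcess_of_forall_not_strictBetween (hUD : D ∪ U = Finset.Icc 1 (n + 1))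
    (hdisj : Disjoint D U) (x : ℕ → ℝ) {u v : ℕ} (hu : u ≤ n + 2) (hv : v ≤ n + 2) (huv : u ≠ v)
    (h : ∀ c, ¬ StrictBetween n D U u v c) : dirExcess n D U x u v = 0 := by
  unfold dirExcess
  split_ifs with hlt
  · exact excess_of_Bel_eq_empty x (Bel_eq_empty hUD hdisj hlt hv h)
  · rw [excess_of_Bel_eq_Icc x (Bel_eq_Icc hUD hdisj (by omega) hu h), sub_self]

theorem Joined.ne {a b : ℕ} (h : Joined n D U T a b) : a ≠ b := by
  rcases h with h | h
  exacts [h.1.ne, h.1.ne']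

theorem IsTriangulation.dirExcess_eq_zero (hUD : D ∪ U = Finset.Icc 1 (n + 1))
    (hdisj : Disjoint D U) (hT : IsTriangulation n D U T) {u v : ℕ} (hu : u ≤ n + 2)
    (hv : v ≤ n + 2) (huv : Joined n D U T u v) :
    dirExcess n D U (xcoord n D U T) u v = 0 := by
  induction hm : relpos n D U u v using Nat.strong_induction_on generalizing u v with
  | _ m ih =>
    by_cases h : ∃ c, StrictBetween n D U u v c
    · obtain ⟨w, hw⟩ := h
      obtain ⟨c, hc, huc, hcv⟩ := hT.exists_triangle hUD hdisj hu hv huv hw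
      have hlt : relpos n D U c v < relpos n D U u v := by
        have h1 := pos_lt hUD hdisj hu
        have h2 := pos_lt hUD hdisj hv
        have h3 := pos_lt hUD hdisj hc.1
        have hcyc := ((strictBetween_iff hUD hdisj hu hv).1 hc).2
        unfold CycBetween at hcyc
        rw [relpos_eq hUD hdisj hc.1 hv, relpos_eq hUD hdisj hu hv]
        split_ifs <;> omega
      rw [hT.dirExcess_add hUD hdisj hu hv hc huv huc hcv,
        ih _ (hm ▸ hc.2.2) hu hc.1 huc rfl, ih _ (hm ▸ hlt) hc.1 hv hcv rfl, add_zero]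
    · exact dirExcess_of_forall_not_strictBetween hUD hdisj _ hu hv huv.ne (by simpa using h)

theorem IsTriangulation.totalExcess_eq_zero (hUD : D ∪ U = Finset.Icc 1 (n + 1))
    (hdisj : Disjoint D U) (hT : IsTriangulation n D U T) :
    totalExcess n (xcoord n D U T) = 0 := by
  obtain ⟨c, hc, h⟩ := exists_relpos_eq_one hUD hdisj (Nat.zero_le (n + 2))
  have hj : Joined n D U T 0 c := joined_of_relpos_eq_one (Nat.zero_le _) hc h
  have h1 := hT.dirExcess_eq_zero hUD hdisj (Nat.zero_le _) hc hj
  have h2 := hT.dirExcess_eq_zero hUD hdisj hc (Nat.zero_le _) hj.symm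
  have hpos : 0 < c := Nat.pos_of_ne_zero hj.ne.symm
  rw [dirExcess, if_pos hpos] at h1
  rw [dirExcess, if_neg (by omega), h1, sub_zero] at h2
  exact h2

theorem IsTriangulation.excess_eq_zero (hUD : D ∪ U = Finset.Icc 1 (n + 1))
    (hdisj : Disjoint D U) (hT : IsTriangulation n D U T) {a b : ℕ} (hab : a < b)
    (hb : b ≤ n + 2) (h : EdgeOf n D U T a b) : excess n D U (xcoord n D U T) (a, b) = 0 := by
  have h1 := hT.dirExcess_eq_zero hUD hdisj (by omega) hb (Or.inl ⟨hab, h⟩)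
  rwa [dirExcess, if_pos hab] at h1

theorem IsTriangulation.excess_nonneg (hUD : D ∪ U = Finset.Icc 1 (n + 1))
    (hdisj : Disjoint D U) (hT : IsTriangulation n D U T) {a b : ℕ} (hab : a < b)
    (hb : b ≤ n + 2) : 0 ≤ excess n D U (xcoord n D U T) (a, b) := by
  induction hm : (T.filter (fun δ => Cross n D U (a, b) δ)).card using Nat.strong_induction_on
    generalizing a b with
  | _ m ih =>
    by_cases h : ∃ δ ∈ T, Cross n D U (a, b) δ
    · obtain ⟨⟨c, d⟩, hT', hcr⟩ := h
      obtain ⟨hcd : c < d, hd : d ≤ n + 2⟩ := (hT.1 _ hT').1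
      obtain ⟨had, hcb⟩ := hcr.fst_lt_snd hUD hdisj hab hb hcd hd
      have hlt := hcr.excess_exchange_lt hUD hdisj (xcoord n D U T) hab hb hcd hd
      rw [hT.excess_eq_zero hUD hdisj hcd hd (Or.inl hT')] at hlt
      have hcard : ∀ a' b', (a' = a ∧ b' = d ∨ a' = c ∧ b' = b) →
          (T.filter (fun δ => Cross n D U (a', b') δ)).card < m := by
        intro a' b' hab'
        rw [← hm]
        refine Finset.card_lt_card (Finset.ssubset_iff_of_subset ?_ |>.2
          ⟨(c, d), Finset.mem_filter.2 ⟨hT', hcr⟩, ?_⟩)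
        · rintro ⟨e, f⟩ hef
          rw [Finset.mem_filter] at hef ⊢
          obtain ⟨hef1 : e < f, hf : f ≤ n + 2⟩ := (hT.1 _ hef.1).1
          refine ⟨hef.1, Cross.of_cross_exchange hUD hdisj (by omega) hb (by omega) hd (by omega)
            hf hcr (hT.2.1 _ hT' _ hef.1) ?_⟩
          rcases hab' with ⟨rfl, rfl⟩ | ⟨rfl, rfl⟩
          exacts [Or.inl hef.2, Or.inr hef.2]
        · rw [Finset.mem_filter]
          rintro ⟨-, hx⟩
          rcases hab' with ⟨rfl, rfl⟩ | ⟨rfl, rfl⟩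
          exacts [hx.2.2.2.2.2.1 rfl, hx.2.2.1 rfl]
      have h1 := ih _ (hcard a d (Or.inl ⟨rfl, rfl⟩)) had hd rfl
      have h2 := ih _ (hcard c b (Or.inr ⟨rfl, rfl⟩)) hcb hb rfl
      linarith
    · push Not at h
      exact (hT.excess_eq_zero hUD hdisj hab hb (hT.edgeOf_of_not_cross hab hb h)).ge

theorem exists_isTriangulation_of_noncrossing (hUD : D ∪ U = Finset.Icc 1 (n + 1))
    (hdisj : Disjoint D U) {W : Finset (ℕ × ℕ)} (hW : ∀ δ ∈ W, IsInternalDiag n D U δ)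
    (hWnc : ∀ δ ∈ W, ∀ δ' ∈ W, ¬ Cross n D U δ δ') :
    ∃ T, IsTriangulation n D U T ∧ W ⊆ T := by
  let E := (Finset.range (n + 3) ×ˢ Finset.range (n + 3)).filter
    (fun δ => IsInternalDiag n D U δ)
  have hE : ∀ δ, IsInternalDiag n D U δ → δ ∈ E := fun δ hδ => by
    have := hδ.1
    simp only [IsDiag] at this
    refine Finset.mem_filter.2 ⟨Finset.mem_product.2 ⟨?_, ?_⟩, hδ⟩ <;> rw [Finset.mem_range] <;>
      omega
  let S := E.powerset.filter (fun T => W ⊆ T ∧ ∀ δ ∈ T, ∀ δ' ∈ T, ¬ Cross n D U δ δ')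
  obtain ⟨T, hTS, hmax⟩ := S.exists_max_image Finset.card
    ⟨W, Finset.mem_filter.2 ⟨Finset.mem_powerset.2 fun δ hδ => hE δ (hW δ hδ),
      Finset.Subset.refl _, hWnc⟩⟩
  obtain ⟨hTE, hWT, hnc⟩ := Finset.mem_filter.1 hTS
  rw [Finset.mem_powerset] at hTE
  have hint : ∀ δ ∈ T, IsInternalDiag n D U δ := fun δ hδ => (Finset.mem_filter.1 (hTE hδ)).2
  refine ⟨T, ⟨hint, hnc, fun δ hδ hδT => ?_⟩, hWT⟩
  by_contra! hc
  have hmem : insert δ T ∈ S := by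
    refine Finset.mem_filter.2 ⟨Finset.mem_powerset.2 (Finset.insert_subset (hE δ hδ) hTE),
      hWT.trans (Finset.subset_insert _ _), fun ε hε ε' hε' => ?_⟩
    rw [Finset.mem_insert] at hε hε'
    rcases hε with rfl | hε <;> rcases hε' with rfl | hε'
    · exact fun h => h.2.2.1 rfl
    · exact hc _ hε'
    · rw [cross_comm hUD hdisj (hint _ hε).1 hδ.1]
      exact hc _ hε
    · exact hnc _ hε _ hε'
  have := hmax _ hmem
  rw [Finset.card_insert_of_notMem hδT] at this
  omega

end Points

section Faces

variable {n : ℕ} {D U : Finset ℕ} {W : Finset (ℕ × ℕ)}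

theorem exists_greatest_le (P : ℕ → Prop) (m : ℕ) :
    ∃ a ≤ m, (a = 0 ∨ P a) ∧ ∀ j, a < j → j ≤ m → ¬ P j := by
  refine ⟨Nat.findGreatest P m, Nat.findGreatest_le m, ?_, fun j h1 h2 =>
    Nat.findGreatest_is_greatest h1 h2⟩
  by_cases h : Nat.findGreatest P m = 0
  · exact Or.inl h
  · exact Or.inr (Nat.findGreatest_of_ne_zero rfl h)

theorem exists_least_gt (P : ℕ → Prop) {m N : ℕ} (hm : m < N) :
    ∃ b ≤ N, m < b ∧ (b = N ∨ P b) ∧ ∀ j, m < j → j < b → ¬ P j := by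
  have hex : ∃ b, m < b ∧ (b = N ∨ P b) := ⟨N, hm, Or.inl rfl⟩
  refine ⟨Nat.find hex, Nat.find_min' hex ⟨hm, Or.inl rfl⟩, (Nat.find_spec hex).1,
    (Nat.find_spec hex).2, fun j h1 h2 h3 => Nat.find_min hex h2 ⟨h1, Or.inr h3⟩⟩

theorem exists_Bel_eq_Icc_one (hUD : D ∪ U = Finset.Icc 1 (n + 1)) (hdisj : Disjoint D U)
    {m : ℕ} (hm : m ≤ n + 1) :
    ∃ a b, a < b ∧ b ≤ n + 2 ∧ Bel n D U (a, b) = Finset.Icc 1 m := by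
  obtain ⟨a, ha, haU, ha'⟩ := exists_greatest_le (· ∈ U) m
  obtain ⟨b, hb, hmb, hbU, hb'⟩ := exists_least_gt (· ∉ U) (show m < n + 2 by omega)
  refine ⟨a, b, by omega, hb, ?_⟩
  have hn : n + 2 ∉ U := fun h => by have := (mem_or_mem hUD).1 (Or.inr h); omega
  ext j
  rw [mem_Bel hUD hdisj (by omega) hb, Finset.mem_Icc, Finset.mem_Icc]
  have h1 := ha' j
  have h2 := hb' j
  unfold Below
  grind

theorem exists_Bel_eq_Icc_top (hUD : D ∪ U = Finset.Icc 1 (n + 1)) (hdisj : Disjoint D U)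
    {m : ℕ} (hm : m ≤ n + 1) :
    ∃ a b, a < b ∧ b ≤ n + 2 ∧ Bel n D U (a, b) = Finset.Icc (m + 1) (n + 1) := by
  obtain ⟨a, ha, haU, ha'⟩ := exists_greatest_le (· ∉ U) m
  obtain ⟨b, hb, hmb, hbU, hb'⟩ := exists_least_gt (· ∈ U) (show m < n + 2 by omega)
  refine ⟨a, b, by omega, hb, ?_⟩
  have h0 : 0 ∉ U := fun h => by have := (mem_or_mem hUD).1 (Or.inr h); omega
  ext j
  rw [mem_Bel hUD hdisj (by omega) hb, Finset.mem_Icc, Finset.mem_Icc]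
  have h1 := ha' j
  have h2 := hb' j
  unfold Below
  grind

theorem excess_of_isBoundaryEdge (hUD : D ∪ U = Finset.Icc 1 (n + 1)) (hdisj : Disjoint D U)
    (x : ℕ → ℝ) {δ : ℕ × ℕ} (h : IsBoundaryEdge n D U δ) :
    excess n D U x δ = 0 ∨ excess n D U x δ = totalExcess n x := by
  obtain ⟨a, b⟩ := δ
  obtain ⟨⟨hab, hb⟩, h | h⟩ := h
  · exact Or.inl (excess_of_Bel_eq_empty x (Bel_eq_empty hUD hdisj hab hb
      fun v hv => by have := hv.2; simp only at h; omega))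
  · exact Or.inr (excess_of_Bel_eq_Icc x (Bel_eq_Icc hUD hdisj hab hb
      fun v hv => by have := hv.2; simp only at h; omega))

/-- The set cut out by the equations and inequalities of the face associated to `W`. -/
def face (n : ℕ) (D U : Finset ℕ) (W : Finset (ℕ × ℕ)) : Set (ℕ → ℝ) :=
  {x | (∀ j, j ∉ Finset.Icc 1 (n + 1) → x j = 0) ∧ totalExcess n x = 0 ∧
    (∀ δ, IsInternalDiag n D U δ → 0 ≤ excess n D U x δ) ∧ ∀ δ ∈ W, excess n D U x δ = 0}

/-- The convex hull of the points of the triangulations refining `W`. -/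
def triHull (n : ℕ) (D U : Finset ℕ) (W : Finset (ℕ × ℕ)) : Set (ℕ → ℝ) :=
  convexHull ℝ {x : ℕ → ℝ | ∃ T : Finset (ℕ × ℕ),
    IsTriangulation n D U T ∧ W ⊆ T ∧ x = xcoord n D U T}

theorem excess_combo (x y : ℕ → ℝ) (δ : ℕ × ℕ) {s t : ℝ} (h : s + t = 1) :
    excess n D U (s • x + t • y) δ = s * excess n D U x δ + t * excess n D U y δ := by
  obtain rfl := eq_sub_of_add_eq h
  simp only [excess, Pi.add_apply, Pi.smul_apply, smul_eq_mul, Finset.sum_add_distrib,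
    ← Finset.mul_sum]
  ring

theorem totalExcess_combo (x y : ℕ → ℝ) {s t : ℝ} (h : s + t = 1) :
    totalExcess n (s • x + t • y) = s * totalExcess n x + t * totalExcess n y := by
  obtain rfl := eq_sub_of_add_eq h
  simp only [totalExcess, Pi.add_apply, Pi.smul_apply, smul_eq_mul, Finset.sum_add_distrib,
    ← Finset.mul_sum]
  ring

theorem convex_face : Convex ℝ (face n D U W) := by
  rintro x ⟨x1, x2, x3, x4⟩ y ⟨y1, y2, y3, y4⟩ s t hs ht hst
  refine ⟨fun j hj => ?_, ?_, fun δ hδ => ?_, fun δ hδ => ?_⟩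
  · simp [x1 j hj, y1 j hj]
  · rw [totalExcess_combo x y hst, x2, y2]
    ring
  · rw [excess_combo x y δ hst]
    exact add_nonneg (mul_nonneg hs (x3 δ hδ)) (mul_nonneg ht (y3 δ hδ))
  · rw [excess_combo x y δ hst, x4 δ hδ, y4 δ hδ]
    ring

theorem IsTriangulation.xcoord_mem_face (hUD : D ∪ U = Finset.Icc 1 (n + 1))
    (hdisj : Disjoint D U) {T : Finset (ℕ × ℕ)} (hT : IsTriangulation n D U T) (hWT : W ⊆ T) :
    xcoord n D U T ∈ face n D U W :=
  ⟨fun _ hj => xcoord_of_notMem hj, hT.totalExcess_eq_zero hUD hdisj,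
    fun _ hδ => hT.excess_nonneg hUD hdisj hδ.1.1 hδ.1.2,
    fun δ hδ => hT.excess_eq_zero hUD hdisj (hT.1 δ (hWT hδ)).1.1 (hT.1 δ (hWT hδ)).1.2
      (Or.inl (hWT hδ))⟩

theorem excess_nonneg_of_mem_face (hUD : D ∪ U = Finset.Icc 1 (n + 1)) (hdisj : Disjoint D U)
    {x : ℕ → ℝ} (hx : x ∈ face n D U W) {a b : ℕ} (hab : a < b) (hb : b ≤ n + 2) :
    0 ≤ excess n D U x (a, b) := by
  by_cases h : IsBoundaryEdge n D U (a, b)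
  · rcases excess_of_isBoundaryEdge hUD hdisj x h with h | h
    exacts [h.ge, (h.trans hx.2.1).ge]
  · exact hx.2.2.1 _ ⟨⟨hab, hb⟩, h⟩

/-- Tight diagonals at a point of the polytope do not cross. -/
theorem not_cross_of_excess_eq_zero (hUD : D ∪ U = Finset.Icc 1 (n + 1)) (hdisj : Disjoint D U)
    {x : ℕ → ℝ} (hx : x ∈ face n D U W) {δ δ' : ℕ × ℕ} (hδ : IsDiag n δ) (hδ' : IsDiag n δ')
    (h : excess n D U x δ = 0) (h' : excess n D U x δ' = 0) : ¬ Cross n D U δ δ' := by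
  obtain ⟨a, b⟩ := δ
  obtain ⟨c, d⟩ := δ'
  intro hcr
  obtain ⟨had, hcb⟩ := hcr.fst_lt_snd hUD hdisj hδ.1 hδ.2 hδ'.1 hδ'.2
  have h1 := hcr.excess_exchange_lt hUD hdisj x hδ.1 hδ.2 hδ'.1 hδ'.2
  have h2 := excess_nonneg_of_mem_face hUD hdisj hx had hδ'.2
  have h3 := excess_nonneg_of_mem_face hUD hdisj hx hcb hδ.2
  linarith

theorem eq_of_excess_le (hUD : D ∪ U = Finset.Icc 1 (n + 1)) (hdisj : Disjoint D U)
    {x p : ℕ → ℝ} (hx : x ∈ face n D U W) (hp : p ∈ face n D U W)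
    (h : ∀ δ, IsInternalDiag n D U δ → excess n D U p δ ≤ excess n D U x δ) : x = p := by
  have hdiag : ∀ a b, a < b → b ≤ n + 2 →
      ∑ j ∈ Bel n D U (a, b), p j ≤ ∑ j ∈ Bel n D U (a, b), x j := by
    intro a b hab hb
    have hle : excess n D U p (a, b) ≤ excess n D U x (a, b) := by
      by_cases hbd : IsBoundaryEdge n D U (a, b)
      · refine le_trans (le_of_eq ?_) (excess_nonneg_of_mem_face hUD hdisj hx hab hb)
        rcases excess_of_isBoundaryEdge hUD hdisj p hbd with h | h
        exacts [h, h.trans hp.2.1]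
      · exact h _ ⟨⟨hab, hb⟩, hbd⟩
    unfold excess at hle
    linarith
  have hprefix : ∀ m ≤ n + 1, ∑ j ∈ Finset.Icc 1 m, x j = ∑ j ∈ Finset.Icc 1 m, p j := by
    intro m hm
    obtain ⟨a, b, hab, hb, hB⟩ := exists_Bel_eq_Icc_one hUD hdisj hm
    obtain ⟨a', b', hab', hb', hB'⟩ := exists_Bel_eq_Icc_top hUD hdisj hm
    have h1 := hdiag a b hab hb
    have h2 := hdiag a' b' hab' hb'
    rw [hB] at h1
    rw [hB'] at h2
    have hsplit : ∀ y : ℕ → ℝ, ∑ j ∈ Finset.Icc 1 m, y j + ∑ j ∈ Finset.Icc (m + 1) (n + 1), y j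
        = ∑ j ∈ Finset.Icc 1 (n + 1), y j := by
      intro y
      rw [← Finset.sum_union (Finset.disjoint_left.2 fun j hj hj' => by
        rw [Finset.mem_Icc] at hj hj'; omega)]
      refine Finset.sum_congr ?_ fun _ _ => rfl
      ext j
      simp only [Finset.mem_union, Finset.mem_Icc]
      omega
    have hxt := hx.2.1
    have hpt := hp.2.1
    unfold totalExcess at hxt hpt
    linarith [hsplit x, hsplit p]
  funext j
  by_cases hj : j ∈ Finset.Icc 1 (n + 1)
  · rw [Finset.mem_Icc] at hj
    obtain ⟨k, rfl⟩ : ∃ k, j = k + 1 := ⟨j - 1, by omega⟩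
    have h1 := hprefix (k + 1) hj.2
    have h2 := hprefix k (by omega)
    rw [Finset.sum_Icc_succ_top (by omega), Finset.sum_Icc_succ_top (by omega), h2] at h1
    exact add_left_cancel h1
  · rw [hx.1 j hj, hp.1 j hj]

/-- The ray from `p` through another point `x` of a face leaves the face at a point where
a further diagonal is tight. -/
theorem exists_exit_point (hUD : D ∪ U = Finset.Icc 1 (n + 1)) (hdisj : Disjoint D U)
    {x p : ℕ → ℝ} (hx : x ∈ face n D U W) (hp : p ∈ face n D U W) (hne : x ≠ p) :
    ∃ δ, IsInternalDiag n D U δ ∧ δ ∉ W ∧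
      ∃ z ∈ face n D U (insert δ W), x ∈ segment ℝ z p := by
  let E := ((Finset.range (n + 3) ×ˢ Finset.range (n + 3)).filter
    (fun δ => IsInternalDiag n D U δ ∧ excess n D U x δ < excess n D U p δ))
  have hE : ∀ δ, IsInternalDiag n D U δ → excess n D U x δ < excess n D U p δ → δ ∈ E := by
    intro δ hδ hlt
    have := hδ.1
    simp only [IsDiag] at this
    refine Finset.mem_filter.2 ⟨Finset.mem_product.2 ⟨?_, ?_⟩, hδ, hlt⟩ <;>
      rw [Finset.mem_range] <;> omega
  have hEne : E.Nonempty := by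
    by_contra hemp
    rw [Finset.not_nonempty_iff_eq_empty] at hemp
    refine hne (eq_of_excess_le hUD hdisj hx hp fun δ hδ => ?_)
    by_contra! hlt
    have := hE δ hδ hlt
    simp [hemp] at this
  obtain ⟨δ, hδE, hmin⟩ := E.exists_min_image
    (fun δ => excess n D U x δ / (excess n D U p δ - excess n D U x δ)) hEne
  obtain ⟨-, hδ, hlt⟩ := Finset.mem_filter.1 hδE
  set s := excess n D U x δ / (excess n D U p δ - excess n D U x δ) with hs
  have hs0 : 0 ≤ s := div_nonneg (hx.2.2.1 δ hδ) (sub_nonneg.2 hlt.le)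
  have hsum : (1 + s) + -s = 1 := by ring
  refine ⟨δ, hδ, fun hW => ?_, (1 + s) • x + (-s) • p, ⟨fun j hj => ?_, ?_, fun ε hε => ?_,
    fun ε hε => ?_⟩, ?_⟩
  · rw [hx.2.2.2 δ hW, hp.2.2.2 δ hW] at hlt
    exact lt_irrefl _ hlt
  · simp [hx.1 j hj, hp.1 j hj]
  · rw [totalExcess_combo x p hsum, hx.2.1, hp.2.1]
    ring
  · rw [excess_combo x p ε hsum]
    by_cases hle : excess n D U x ε < excess n D U p ε
    · have := hmin ε (hE ε hε hle)
      rw [le_div_iff₀ (sub_pos.2 hle)] at this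
      linarith
    · have := mul_nonneg hs0 (sub_nonneg.2 (not_lt.1 hle))
      have := hx.2.2.1 ε hε
      linarith
  · rw [excess_combo x p ε hsum]
    rcases Finset.mem_insert.1 hε with rfl | hε
    · have : s * (excess n D U p ε - excess n D U x ε) = excess n D U x ε :=
        div_mul_cancel₀ _ (sub_pos.2 hlt).ne'
      linarith
    · rw [hx.2.2.2 ε hε, hp.2.2.2 ε hε]
      ring
  · have hs1 : 1 + s ≠ 0 := by positivity
    refine ⟨1 / (1 + s), s / (1 + s), by positivity, by positivity, by field_simp, ?_⟩
    funext j
    simp only [Pi.add_apply, Pi.smul_apply, smul_eq_mul]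
    field_simp
    ring

theorem face_subset_triHull (hUD : D ∪ U = Finset.Icc 1 (n + 1)) (hdisj : Disjoint D U)
    (hW : ∀ δ ∈ W, IsInternalDiag n D U δ) (hWnc : ∀ δ ∈ W, ∀ δ' ∈ W, ¬ Cross n D U δ δ') :
    face n D U W ⊆ triHull n D U W := by
  induction hm : ((Finset.range (n + 3) ×ˢ Finset.range (n + 3)) \ W).card
    using Nat.strong_induction_on generalizing W with
  | _ m ih =>
    intro x hx
    obtain ⟨T, hT, hWT⟩ := exists_isTriangulation_of_noncrossing hUD hdisj hW hWnc
    have hp : xcoord n D U T ∈ triHull n D U W := subset_convexHull ℝ _ ⟨T, hT, hWT, rfl⟩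
    by_cases hne : x = xcoord n D U T
    · exact hne ▸ hp
    obtain ⟨δ, hδ, hδW, z, hz, hseg⟩ :=
      exists_exit_point hUD hdisj hx (hT.xcoord_mem_face hUD hdisj hWT) hne
    have hint : ∀ ε ∈ insert δ W, IsInternalDiag n D U ε := by
      intro ε hε
      rcases Finset.mem_insert.1 hε with rfl | hε
      exacts [hδ, hW ε hε]
    have hlt : ((Finset.range (n + 3) ×ˢ Finset.range (n + 3)) \ insert δ W).card < m := by
      rw [← hm]
      refine Finset.card_lt_card (Finset.ssubset_iff_of_subset
        (Finset.sdiff_subset_sdiff subset_rfl (Finset.subset_insert _ _)) |>.2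
        ⟨δ, Finset.mem_sdiff.2 ⟨Finset.mem_product.2 ?_, hδW⟩, by simp⟩)
      have := hδ.1
      simp only [IsDiag] at this
      constructor <;> rw [Finset.mem_range] <;> omega
    have hz' := ih _ hlt hint (fun ε hε ε' hε' => not_cross_of_excess_eq_zero hUD hdisj hz
      (hint ε hε).1 (hint ε' hε').1 (hz.2.2.2 ε hε) (hz.2.2.2 ε' hε')) rfl hz
    have hmono : triHull n D U (insert δ W) ⊆ triHull n D U W :=
      convexHull_mono fun y ⟨T', hT', hsub, hy⟩ =>
        ⟨T', hT', (Finset.subset_insert _ _).trans hsub, hy⟩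
    exact (convex_convexHull ℝ _).segment_subset (hmono hz') hp hseg

end Faces

/-- For every dissection `W` of `P`, the convex hull of the points
`x(T)` over triangulations `T ⊇ W` equals the set of points `x ∈ ℝ^{n+1}` (encoded as
functions supported on `[n+1]`) satisfying the defining equality and inequalities of the
associahedron together with equality for all `δ ∈ W`. -/
theorem face_of_dissection (n : ℕ) (hn : 1 ≤ n) (D U : Finset ℕ)
    (hUD : D ∪ U = Finset.Icc 1 (n + 1)) (hdisj : Disjoint D U)
    (W : Finset (ℕ × ℕ)) (hW : ∀ δ ∈ W, IsInternalDiag n D U δ)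
    (hWnc : ∀ δ ∈ W, ∀ δ' ∈ W, ¬ Cross n D U δ δ') :
    convexHull ℝ {x : ℕ → ℝ | ∃ T : Finset (ℕ × ℕ),
        IsTriangulation n D U T ∧ W ⊆ T ∧ x = xcoord n D U T}
      = {x : ℕ → ℝ |
          (∀ j : ℕ, j ∉ Finset.Icc 1 (n + 1) → x j = 0) ∧
          (∑ j ∈ Finset.Icc 1 (n + 1), x j = ((n : ℝ) + 2) * ((n : ℝ) + 1) / 2) ∧
          (∀ δ : ℕ × ℕ, IsInternalDiag n D U δ →
            ((bel n D U δ : ℝ) + 1) * (bel n D U δ : ℝ) / 2 ≤ ∑ j ∈ Bel n D U δ, x j) ∧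
          (∀ δ ∈ W, ∑ j ∈ Bel n D U δ, x j
              = ((bel n D U δ : ℝ) + 1) * (bel n D U δ : ℝ) / 2)} := by
  have hface : triHull n D U W = face n D U W := by
    refine Set.Subset.antisymm (convexHull_min ?_ convex_face)
      (face_subset_triHull hUD hdisj hW hWnc)
    rintro x ⟨T, hT, hWT, rfl⟩
    exact hT.xcoord_mem_face hUD hdisj hWT
  unfold triHull at hface
  rw [hface]
  ext x
  simp only [face, excess, totalExcess, Set.mem_ofPred_eq, sub_eq_zero, sub_nonneg]

end Spines
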